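/- For any two continua K⁻ and K⁺ in the Riemann sphere, there exists an entire function f : ℂ → ℂ with deriv f x ≠ 0 for every real x, whose real restriction has cluster set K⁻ at −∞ and K⁺ at +∞, and which in addition satisfies: there is no c ∈ ℂ such that t ↦ deriv f t / ‖deriv f t‖ (t ∈ ℝ) tends to c as t → +∞, and there is no c ∈ ℂ such that it tends to c as t → −∞ (so the tangent direction of the curve diverges at both ends). -/

import Mathlib

open Filter Topology

/-- Two complex numbers are linked when they are `ε`-close and both lie in `U`. -/
def Link (U : Set (OnePoint ℂ)) (ε : ℝ) (a b : ℂ) : Prop :=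
  (a : OnePoint ℂ) ∈ U ∧ (b : OnePoint ℂ) ∈ U ∧ dist a b < ε

lemma Link.symm {U : Set (OnePoint ℂ)} {ε : ℝ} {a b : ℂ} (h : Link U ε a b) : Link U ε b a :=
  ⟨h.2.1, h.1, dist_comm a b ▸ h.2.2⟩

lemma transGen_link_symm {U : Set (OnePoint ℂ)} {ε : ℝ} {a b : ℂ}
    (h : Relation.TransGen (Link U ε) a b) : Relation.TransGen (Link U ε) b a :=
  have : Std.Symm (Link U ε) := ⟨fun _ _ => Link.symm⟩
  Std.Symm.symm _ _ h

lemma transGen_link_of_isPreconnected {U : Set (OnePoint ℂ)} {ε : ℝ} (hε : 0 < ε) {S : Set ℂ}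
    (hS : IsPreconnected S) (hSU : ∀ a ∈ S, (a : OnePoint ℂ) ∈ U) {a b : ℂ} (ha : a ∈ S)
    (hb : b ∈ S) : Relation.TransGen (Link U ε) a b := by
  refine hS.induction₂ (Relation.TransGen (Link U ε)) ?_ (fun _ _ _ _ _ _ => .trans)
    (fun _ _ _ _ h => transGen_link_symm h) ha hb
  intro x hx
  filter_upwards [self_mem_nhdsWithin, mem_nhdsWithin_of_mem_nhds (Metric.ball_mem_nhds x hε)]
    with y hy hxy
  exact .single ⟨hSU x hx, hSU y hy, by rwa [dist_comm]⟩

lemma isPreconnected_setOf_lt_norm {R : ℝ} (hR : 0 < R) : IsPreconnected {z : ℂ | R < ‖z‖} := by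
  have : {z : ℂ | R < ‖z‖} = Complex.exp '' {z | Real.log R < z.re} := by
    ext z
    simp only [Set.mem_ofPred_eq, Set.mem_image]
    constructor
    · intro hz
      have hz0 : z ≠ 0 := norm_pos_iff.1 (hR.trans hz)
      exact ⟨Complex.log z, by rw [Complex.log_re]; exact Real.log_lt_log hR hz,
        Complex.exp_log hz0⟩
    · rintro ⟨w, hw, rfl⟩
      rw [Complex.norm_exp]
      exact (Real.log_lt_iff_lt_exp hR).1 hw
  rw [this]
  exact (convex_halfSpace_re_gt _).isPreconnected.image _ Complex.continuous_exp.continuousOn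

/-- Every point of an open subset of the sphere has a neighbourhood whose finite points are
connected to each other by fine chains. -/
lemma exists_nhds_transGen_link {U : Set (OnePoint ℂ)} (hU : IsOpen U) {ε : ℝ} (hε : 0 < ε)
    {x : OnePoint ℂ} (hx : x ∈ U) :
    ∃ W : Set (OnePoint ℂ), IsOpen W ∧ x ∈ W ∧
      ∀ a b : ℂ, (a : OnePoint ℂ) ∈ W → (b : OnePoint ℂ) ∈ W →
        Relation.TransGen (Link U ε) a b := by
  suffices h : ∃ S : Set ℂ, IsPreconnected S ∧ (∀ a ∈ S, (a : OnePoint ℂ) ∈ U) ∧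
      ∃ W ∈ 𝓝 x, ∀ a : ℂ, (a : OnePoint ℂ) ∈ W → a ∈ S by
    obtain ⟨S, hS, hSU, W, hW, hWS⟩ := h
    obtain ⟨V, hVW, hV, hxV⟩ := mem_nhds_iff.1 hW
    exact ⟨V, hV, hxV, fun a b ha hb => transGen_link_of_isPreconnected hε hS hSU
      (hWS a (hVW ha)) (hWS b (hVW hb))⟩
  induction x using OnePoint.rec with
  | infty =>
    have hmem : ((↑) : ℂ → OnePoint ℂ) ⁻¹' U ∈ Bornology.cobounded ℂ := by
      rw [Metric.cobounded_eq_cocompact, ← coclosedCompact_eq_cocompact,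
        ← OnePoint.comap_coe_nhds_infty]
      exact preimage_mem_comap (hU.mem_nhds hx)
    obtain ⟨R, -, hR⟩ := (hasBasis_cobounded_norm (E := ℂ)).mem_iff.1 hmem
    have hpos : 0 < max R 1 := lt_max_of_lt_right one_pos
    refine ⟨{z | max R 1 < ‖z‖}, isPreconnected_setOf_lt_norm hpos, ?_, ?_⟩
    · intro a ha
      exact hR ((le_max_left R 1).trans (le_of_lt ha))
    · have : {z : ℂ | max R 1 < ‖z‖} ∈ comap ((↑) : ℂ → OnePoint ℂ) (𝓝 OnePoint.infty) := by
        rw [OnePoint.comap_coe_nhds_infty, coclosedCompact_eq_cocompact,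
          ← Metric.cobounded_eq_cocompact]
        exact tendsto_norm_cobounded_atTop.eventually_gt_atTop _
      obtain ⟨W, hW, hWS⟩ := mem_comap.1 this
      exact ⟨W, hW, fun a ha => hWS ha⟩
  | coe x =>
    have hmem : ((↑) : ℂ → OnePoint ℂ) ⁻¹' U ∈ 𝓝 x :=
      (hU.preimage OnePoint.continuous_coe).mem_nhds hx
    obtain ⟨r, hr, hrU⟩ := Metric.mem_nhds_iff.1 hmem
    refine ⟨Metric.ball x r, (convex_ball x r).isPreconnected, fun a ha => hrU ha,
      (↑) '' Metric.ball x r, ?_, ?_⟩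
    · exact OnePoint.isOpenEmbedding_coe.image_mem_nhds.2 (Metric.ball_mem_nhds x hr)
    · rintro a ⟨b, hb, hab⟩
      exact OnePoint.coe_injective hab ▸ hb

lemma exists_coe_mem_of_isOpen {W : Set (OnePoint ℂ)} (hW : IsOpen W) {x : OnePoint ℂ}
    (hx : x ∈ W) : ∃ a : ℂ, (a : OnePoint ℂ) ∈ W :=
  OnePoint.denseRange_coe.exists_mem_open hW ⟨x, hx⟩

/-- A connected subset of the sphere has a neighbourhood whose finite points are connected to each
other by fine chains. -/
lemma IsPreconnected.exists_isOpen_transGen_link {K U : Set (OnePoint ℂ)} (hK : IsPreconnected K)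
    (hU : IsOpen U) (hKU : K ⊆ U) {ε : ℝ} (hε : 0 < ε) :
    ∃ N : Set (OnePoint ℂ), IsOpen N ∧ K ⊆ N ∧
      ∀ a b : ℂ, (a : OnePoint ℂ) ∈ N → (b : OnePoint ℂ) ∈ N →
        Relation.TransGen (Link U ε) a b := by
  choose! W hWo hxW hW using fun x (hx : x ∈ K) => exists_nhds_transGen_link hU hε (hKU hx)
  have key : ∀ x ∈ K, ∀ y ∈ K, ∀ a b : ℂ, (a : OnePoint ℂ) ∈ W x → (b : OnePoint ℂ) ∈ W y →
      Relation.TransGen (Link U ε) a b := by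
    intro x hx y hy
    refine hK.induction₂ (fun x y => ∀ a b : ℂ, (a : OnePoint ℂ) ∈ W x → (b : OnePoint ℂ) ∈ W y →
      Relation.TransGen (Link U ε) a b) ?_ ?_ ?_ hx hy
    · intro x hx
      filter_upwards [self_mem_nhdsWithin,
        mem_nhdsWithin_of_mem_nhds ((hWo x hx).mem_nhds (hxW x hx))]
        with y hy hyx a b ha hb
      obtain ⟨c, hcx, hcy⟩ := exists_coe_mem_of_isOpen ((hWo x hx).inter (hWo y hy)) ⟨hyx, hxW y hy⟩
      exact (hW x hx a c ha hcx).trans (hW y hy c b hcy hb)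
    · intro x y z _ hy _ hxy hyz a b ha hb
      obtain ⟨c, hc⟩ := exists_coe_mem_of_isOpen (hWo y hy) (hxW y hy)
      exact (hxy a c ha hc).trans (hyz c b hc hb)
    · intro x y _ _ h a b ha hb
      exact transGen_link_symm (h b a hb ha)
  refine ⟨⋃ x ∈ K, W x, isOpen_biUnion hWo, fun x hx => Set.mem_biUnion hx (hxW x hx), ?_⟩
  intro a b ha hb
  simp only [Set.mem_iUnion, exists_prop] at ha hb
  obtain ⟨x, hx, hax⟩ := ha
  obtain ⟨y, hy, hby⟩ := hb
  exact key x hx y hy a b hax hby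

lemma Relation.TransGen.exists_path {α : Type*} {R : α → α → Prop} {a b : α}
    (h : Relation.TransGen R a b) :
    ∃ (L : ℕ) (c : ℕ → α), 0 < L ∧ c 0 = a ∧ c L = b ∧ ∀ i < L, R (c i) (c (i + 1)) := by
  induction h using Relation.TransGen.head_induction_on with
  | @single a h =>
    refine ⟨1, fun i => Nat.casesOn i a fun _ => b, one_pos, rfl, rfl, ?_⟩
    intro i hi
    obtain rfl : i = 0 := by lia
    exact h
  | @head a d h _ ih =>
    obtain ⟨L, c, -, h0, hL, hc⟩ := ih
    refine ⟨L + 1, fun i => Nat.casesOn i a c, L.succ_pos, rfl, hL, ?_⟩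
    rintro (_ | i) hi
    · simpa [h0] using h
    · exact hc i (by lia)

/-- Infinitely many finite chains can be concatenated into one sequence. -/
lemma exists_seq_of_transGen {α : Type*} (R : ℕ → α → α → Prop) (a : ℕ → α)
    (h : ∀ n, Relation.TransGen (R n) (a n) (a (n + 1))) :
    ∃ (z : ℕ → α) (k : ℕ → ℕ), Tendsto k atTop atTop ∧
      (∀ m, R (k m) (z m) (z (m + 1))) ∧ ∀ n, ∃ m ≥ n, z m = a n := by
  choose L c hL h0 hend hc using fun n => (h n).exists_path
  let s : ℕ → ℕ × ℕ := fun m => Nat.rec (0, 0)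
    (fun _ p => if p.2 + 1 < L p.1 then (p.1, p.2 + 1) else (p.1 + 1, 0)) m
  have s_succ : ∀ m, s (m + 1) = if (s m).2 + 1 < L (s m).1 then ((s m).1, (s m).2 + 1)
      else ((s m).1 + 1, 0) := fun m => rfl
  have hlt : ∀ m, (s m).2 < L (s m).1 := by
    intro m
    induction m with
    | zero => exact hL 0
    | succ m ih =>
      rw [s_succ]
      split_ifs with hm
      · exact hm
      · exact hL _
  have hmono : Monotone fun m => (s m).1 := by
    refine monotone_nat_of_le_succ fun m => ?_
    rw [s_succ]
    split_ifs <;> simp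
  have hle : ∀ m, (s m).1 ≤ m := by
    intro m
    induction m with
    | zero => exact le_rfl
    | succ m ih =>
      rw [s_succ]
      split_ifs <;> simp <;> lia
  have hvisit : ∀ n, ∃ m, s m = (n, 0) := by
    intro n
    induction n with
    | zero => exact ⟨0, rfl⟩
    | succ n ih =>
      obtain ⟨m, hm⟩ := ih
      have hi : ∀ i < L n, s (m + i) = (n, i) := by
        intro i
        induction i with
        | zero => exact fun _ => hm
        | succ i ih =>
          intro hi
          rw [← add_assoc, s_succ, ih (by lia), if_pos hi]
      refine ⟨m + (L n - 1) + 1, ?_⟩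
      rw [s_succ, hi _ (by have := hL n; lia), if_neg (by have := hL n; simp; lia)]
  refine ⟨fun m => c (s m).1 (s m).2, fun m => (s m).1, ?_, ?_, ?_⟩
  · refine tendsto_atTop_atTop_of_monotone hmono fun n => ?_
    obtain ⟨m, hm⟩ := hvisit n
    exact ⟨m, by rw [hm]⟩
  · intro m
    have hRm := hc (s m).1 (s m).2 (hlt m)
    dsimp only
    rw [s_succ]
    split_ifs with hm
    · exact hRm
    · have : (s m).2 + 1 = L (s m).1 := by have := hlt m; lia
      rw [this, hend] at hRm
      rwa [h0]
  · intro n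
    obtain ⟨m, hm⟩ := hvisit n
    refine ⟨m, ?_, by simpa only [hm] using h0 n⟩
    have := hle m
    rwa [hm] at this

instance OnePoint.instMetrizableSpaceComplex : TopologicalSpace.MetrizableSpace (OnePoint ℂ) :=
  (onePointEquivSphereOfFinrankEq (ι := Fin 3) (V := ℂ)
    (by simp [Complex.finrank_real_complex])).isEmbedding.metrizableSpace

/-- In a metrizable space, every nonempty compact set is the cluster set of a sequence. -/
lemma IsCompact.exists_seq_mapClusterPt {X : Type*} [MetricSpace X] {K : Set X}
    (hK : IsCompact K) (hne : K.Nonempty) :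
    ∃ p : ℕ → X, (∀ n, p n ∈ K) ∧ ∀ x ∈ K, MapClusterPt x atTop p := by
  have : Nonempty K := hne.to_subtype
  have := isCompact_iff_compactSpace.1 hK
  obtain ⟨d, hd⟩ := TopologicalSpace.exists_dense_seq K
  refine ⟨fun n => d n.unpair.1, fun n => (d _).2, fun x hx => ?_⟩
  rw [mapClusterPt_iff_frequently]
  intro s hs
  have hs' : ((↑) : K → X) ⁻¹' s ∈ 𝓝 (⟨x, hx⟩ : K) := continuous_subtype_val.continuousAt hs
  obtain ⟨j, hj⟩ := hd.exists_mem_open isOpen_interior ⟨_, mem_interior_iff_mem_nhds.2 hs'⟩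
  rw [frequently_atTop]
  intro n
  refine ⟨Nat.pair j n, Nat.right_le_pair j n, ?_⟩
  rw [Nat.unpair_pair]
  exact interior_subset (s := ((↑) : K → X) ⁻¹' s) hj

/-- Every continuum in the sphere is the cluster set of a sequence of complex numbers whose steps
tend to zero. -/
lemma exists_seq_cluster_eq {K : Set (OnePoint ℂ)} (hK : IsCompact K) (hconn : IsConnected K) :
    ∃ z : ℕ → ℂ, (∀ m, dist (z m) (z (m + 1)) ≤ 1) ∧
      Tendsto (fun m => dist (z m) (z (m + 1))) atTop (𝓝 0) ∧
      {w : OnePoint ℂ | MapClusterPt w atTop fun m => (z m : OnePoint ℂ)} = K := by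
  let _ : MetricSpace (OnePoint ℂ) := TopologicalSpace.metrizableSpaceMetric (OnePoint ℂ)
  obtain ⟨p, hpK, hp⟩ := hK.exists_seq_mapClusterPt hconn.nonempty
  have hr : ∀ n : ℕ, 0 < 1 / ((n : ℝ) + 1) := fun n => Nat.one_div_pos_of_nat
  choose N hNo hKN hN using fun n : ℕ => hconn.isPreconnected.exists_isOpen_transGen_link
    Metric.isOpen_thickening (Metric.self_subset_thickening (hr n) K) (hr n)
  have ha : ∀ n : ℕ, ∃ a : ℂ, (a : OnePoint ℂ) ∈
      (N n ∩ N (n - 1)) ∩ Metric.ball (p n) (1 / ((n : ℝ) + 1)) := fun n =>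
    exists_coe_mem_of_isOpen (((hNo n).inter (hNo (n - 1))).inter Metric.isOpen_ball)
      ⟨⟨hKN _ (hpK n), hKN _ (hpK n)⟩, Metric.mem_ball_self (hr n)⟩
  choose a ha using ha
  obtain ⟨z, k, hk, hz, hza⟩ := exists_seq_of_transGen
    (fun n => Link (Metric.thickening (1 / ((n : ℝ) + 1)) K) (1 / ((n : ℝ) + 1))) a
    (fun n => hN n _ _ (ha n).1.1 (ha (n + 1)).1.2)
  have hlim : Tendsto (fun m => 1 / ((k m : ℝ) + 1)) atTop (𝓝 0) :=
    tendsto_one_div_add_atTop_nhds_zero_nat.comp hk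
  refine ⟨z, fun m => (hz m).2.2.le.trans ?_, squeeze_zero (fun _ => dist_nonneg)
    (fun m => (hz m).2.2.le) hlim, Set.Subset.antisymm ?_ ?_⟩
  · rw [div_le_one (by positivity)]
    linarith [Nat.cast_nonneg (α := ℝ) (k m)]
  · intro w hw
    rw [← hK.isClosed.closure_eq, Metric.mem_closure_iff]
    intro ε hε
    have hev : ∀ᶠ m in atTop, 1 / ((k m : ℝ) + 1) < ε / 2 :=
      hlim.eventually (gt_mem_nhds (half_pos hε))
    obtain ⟨m, hm, hm'⟩ := ((mapClusterPt_iff_frequently.1 hw _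
      (Metric.ball_mem_nhds w (half_pos hε))).and_eventually hev).exists
    obtain ⟨q, hq, hqz⟩ := Metric.mem_thickening_iff.1 (hz m).1
    refine ⟨q, hq, ?_⟩
    have h1 := Metric.mem_ball.1 hm
    rw [dist_comm] at h1
    linarith [dist_triangle w (z m : OnePoint ℂ) q]
  · intro w hw
    rw [Set.mem_ofPred_eq, mapClusterPt_iff_frequently]
    intro s hs
    obtain ⟨ε, hε, hεs⟩ := Metric.mem_nhds_iff.1 hs
    rw [frequently_atTop]
    intro n
    have hev : ∀ᶠ m : ℕ in atTop, 1 / ((m : ℝ) + 1) < ε / 2 :=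
      tendsto_one_div_add_atTop_nhds_zero_nat.eventually (gt_mem_nhds (half_pos hε))
    obtain ⟨j, hj, hj', hnj⟩ := ((mapClusterPt_iff_frequently.1 (hp w hw) _
      (Metric.ball_mem_nhds w (half_pos hε))).and_eventually
        (hev.and (eventually_ge_atTop n))).exists
    obtain ⟨m, hjm, hzm⟩ := hza j
    refine ⟨m, hnj.trans hjm, hεs ?_⟩
    rw [hzm, Metric.mem_ball]
    have h1 := Metric.mem_ball.1 (ha j).2
    have h2 := Metric.mem_ball.1 hj
    linarith [dist_triangle (a j : OnePoint ℂ) (p j) w]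

open MeasureTheory in
lemma integrable_one_add_sq_mul_exp {b : ℝ} (hb : 0 < b) :
    Integrable fun s : ℝ => (1 + s ^ 2) * Real.exp (-b * s ^ 2) := by
  have h := integrable_rpow_mul_exp_neg_mul_sq hb (s := 2) (by norm_num)
  refine ((integrable_exp_neg_mul_sq hb).add h).congr (.of_forall fun s => ?_)
  simp only [Pi.add_apply, Real.rpow_two]
  ring

lemma norm_cexp_neg_sub_sq_le (z : ℂ) (s : ℝ) :
    ‖Complex.exp (-(z - s) ^ 2)‖ ≤ Real.exp (‖z‖ ^ 2) * Real.exp (-(1 / 2) * s ^ 2) := by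
  rw [Complex.norm_exp, ← Real.exp_add, Real.exp_le_exp, Complex.sq_norm, Complex.normSq_apply]
  simp only [sq, Complex.neg_re, Complex.mul_re, Complex.sub_re, Complex.ofReal_re,
    Complex.sub_im, Complex.ofReal_im, sub_zero]
  nlinarith [sq_nonneg (s - 2 * z.re)]

open MeasureTheory in
/-- Convolution of a function of at most linear growth with a Gaussian is entire. -/
lemma hasDerivAt_integral_mul_gaussian {γ : ℝ → ℂ} (hγ : Measurable γ) {B : ℝ}
    (hB : ∀ s, ‖γ s‖ ≤ B * (1 + |s|)) (z : ℂ) :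
    HasDerivAt (fun z : ℂ => ∫ s : ℝ, γ s * Complex.exp (-(z - s) ^ 2))
      (∫ s : ℝ, γ s * (-(2 * (z - s)) * Complex.exp (-(z - s) ^ 2))) z := by
  have hB0 : 0 ≤ B := by simpa using (norm_nonneg _).trans (hB 0)
  set R := ‖z‖ + 1
  have hR : 1 ≤ R := by simp [R]
  let bound : ℝ → ℝ := fun s =>
    (8 * B * R * Real.exp (R ^ 2)) * ((1 + s ^ 2) * Real.exp (-(1 / 2) * s ^ 2))
  have hbound : Integrable bound := (integrable_one_add_sq_mul_exp (by norm_num)).const_mul _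
  have key : ∀ (s : ℝ) (q v : ℂ), ‖q‖ ≤ R → ‖v‖ ≤ 2 * (R + |s|) →
      ‖γ s * (v * Complex.exp (-(q - s) ^ 2))‖ ≤ bound s := by
    intro s q v hq hv
    have h1 := norm_cexp_neg_sub_sq_le q s
    have h2 : Real.exp (‖q‖ ^ 2) ≤ Real.exp (R ^ 2) := by gcongr
    have h3 : (1 + |s|) * (2 * (R + |s|)) ≤ 8 * R * (1 + s ^ 2) := by
      have h4 : R + |s| ≤ R * (1 + |s|) := by nlinarith [abs_nonneg s]
      have h5 : (1 + |s|) * (1 + |s|) ≤ 2 * (1 + s ^ 2) := by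
        nlinarith [sq_abs s, sq_nonneg (1 - |s|)]
      calc (1 + |s|) * (2 * (R + |s|)) ≤ (1 + |s|) * (2 * (R * (1 + |s|))) := by gcongr
        _ = 2 * R * ((1 + |s|) * (1 + |s|)) := by ring
        _ ≤ 2 * R * (2 * (1 + s ^ 2)) := by gcongr
        _ ≤ _ := by nlinarith [sq_nonneg s, mul_nonneg (zero_le_one.trans hR) (sq_nonneg s)]
    calc ‖γ s * (v * Complex.exp (-(q - s) ^ 2))‖
        = ‖γ s‖ * (‖v‖ * ‖Complex.exp (-(q - s) ^ 2)‖) := by rw [norm_mul, norm_mul]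
      _ ≤ (B * (1 + |s|)) * ((2 * (R + |s|)) *
          (Real.exp (R ^ 2) * Real.exp (-(1 / 2) * s ^ 2))) := by
        gcongr
        · exact hB s
        · exact h1.trans (by gcongr)
      _ = B * ((1 + |s|) * (2 * (R + |s|))) *
          (Real.exp (R ^ 2) * Real.exp (-(1 / 2) * s ^ 2)) := by ring
      _ ≤ B * (8 * R * (1 + s ^ 2)) * (Real.exp (R ^ 2) * Real.exp (-(1 / 2) * s ^ 2)) := by
        gcongr
      _ = bound s := by simp only [bound]; ring
  have hmeas : ∀ q : ℂ, AEStronglyMeasurable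
      (fun s : ℝ => γ s * Complex.exp (-(q - s) ^ 2)) volume := fun q =>
    hγ.aestronglyMeasurable.mul (by fun_prop : Continuous fun s : ℝ =>
      Complex.exp (-(q - s) ^ 2)).aestronglyMeasurable
  refine (hasDerivAt_integral_of_dominated_loc_of_deriv_le (bound := bound)
    (F' := fun (z : ℂ) (s : ℝ) => γ s * (-(2 * (z - s)) * Complex.exp (-(z - s) ^ 2)))
    (Metric.ball_mem_nhds z one_pos) (.of_forall hmeas) ?_ ?_ ?_ hbound ?_).2
  · refine hbound.mono' (hmeas z) (.of_forall fun s => ?_)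
    have := key s z 1 (by simp [R]) (by rw [norm_one]; nlinarith [abs_nonneg s])
    rwa [one_mul] at this
  · exact hγ.aestronglyMeasurable.mul (by fun_prop : Continuous fun s : ℝ =>
      -(2 * (z - s)) * Complex.exp (-(z - s) ^ 2)).aestronglyMeasurable
  · refine .of_forall fun s q hq => ?_
    have hqR : ‖q‖ ≤ R := by
      have h1 := mem_ball_iff_norm.1 hq
      have h2 := norm_le_norm_add_norm_sub' q z
      simp only [R]
      linarith
    refine key s q _ hqR ?_
    rw [norm_neg, norm_mul, Complex.norm_ofNat]
    have := norm_sub_le q (s : ℂ)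
    rw [Complex.norm_real, Real.norm_eq_abs] at this
    linarith
  · refine .of_forall fun s q _ => ?_
    have h : HasDerivAt (fun q : ℂ => -(q - (s : ℂ)) ^ 2) (-(2 * (q - s))) q := by
      refine (((hasDerivAt_id q).sub_const (s : ℂ)).pow 2).neg.congr_deriv ?_
      simp
    simpa [mul_comm] using h.cexp.const_mul (γ s)

section Weight

open MeasureTheory

variable {γ : ℝ → ℂ} {C : ℝ} {w : ℝ → ℂ}

lemma norm_sub_mul_weight_le (hC : ∀ x y, ‖γ x - γ y‖ ≤ C * (1 + |x - y|))
    (x u : ℝ) :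
    ‖(γ (x - u) - γ x) * w u‖ ≤ C * ((1 + |u|) * ‖w u‖) := by
  rw [norm_mul, ← mul_assoc]
  gcongr
  simpa using hC (x - u) x

lemma aestronglyMeasurable_sub_mul_weight (hγ : Measurable γ) (hw : Continuous w)
    (x : ℝ) :
    AEStronglyMeasurable (fun u => (γ (x - u) - γ x) * w u) volume :=
  (((hγ.comp (measurable_const.sub measurable_id)).sub_const _).mul
    hw.measurable).aestronglyMeasurable

lemma integral_comp_sub_mul_weight (hγ : Measurable γ)
    (hC : ∀ x y, ‖γ x - γ y‖ ≤ C * (1 + |x - y|)) (hw : Continuous w)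
    (hwi : Integrable fun u => (1 + |u|) * ‖w u‖) (x : ℝ) :
    ∫ u, γ (x - u) * w u = (∫ u, (γ (x - u) - γ x) * w u) + γ x * ∫ u, w u := by
  have hw' : Integrable w := hwi.mono' hw.aestronglyMeasurable (.of_forall fun u => by
    nlinarith [abs_nonneg u, norm_nonneg (w u), mul_nonneg (abs_nonneg u) (norm_nonneg (w u))])
  rw [← integral_const_mul, ← integral_add]
  · congr with u
    ring
  · exact (hwi.const_mul C).mono' (aestronglyMeasurable_sub_mul_weight hγ hw x)
      (.of_forall fun u => norm_sub_mul_weight_le hC x u)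
  · exact hw'.const_mul _

lemma norm_integral_sub_mul_weight_le
    (hC : ∀ x y, ‖γ x - γ y‖ ≤ C * (1 + |x - y|))
    (hwi : Integrable fun u => (1 + |u|) * ‖w u‖) (x : ℝ) :
    ‖∫ u, (γ (x - u) - γ x) * w u‖ ≤ ∫ u, C * ((1 + |u|) * ‖w u‖) :=
  norm_integral_le_of_norm_le (hwi.const_mul C)
    (.of_forall fun u => norm_sub_mul_weight_le hC x u)

lemma tendsto_integral_sub_mul_weight (hγ : Measurable γ)
    (hC : ∀ x y, ‖γ x - γ y‖ ≤ C * (1 + |x - y|)) (hw : Continuous w)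
    (hwi : Integrable fun u => (1 + |u|) * ‖w u‖)
    {l : Filter ℝ} [l.IsCountablyGenerated]
    (hl : ∀ u, Tendsto (fun x => γ (x - u) - γ x) l (𝓝 0)) :
    Tendsto (fun x => ∫ u, (γ (x - u) - γ x) * w u) l (𝓝 0) := by
  have := tendsto_integral_filter_of_dominated_convergence (μ := volume) (l := l)
    (F := fun x u => (γ (x - u) - γ x) * w u) (f := fun _ => 0) _
    (.of_forall fun x => aestronglyMeasurable_sub_mul_weight hγ hw x)
    (.of_forall fun x => .of_forall fun u => norm_sub_mul_weight_le hC x u)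
    (hwi.const_mul C) (.of_forall fun u => by simpa using (hl u).mul_const (w u))
  simpa using this

end Weight

open MeasureTheory in
/-- A slowly varying function on the line is asymptotic to the restriction of an entire function
whose derivative is bounded on the line and tends to zero at infinity. -/
lemma exists_entire_approx {γ : ℝ → ℂ} (hγ : Measurable γ) {C : ℝ}
    (hC : ∀ x y, ‖γ x - γ y‖ ≤ C * (1 + |x - y|)) :
    ∃ F F' : ℂ → ℂ, (∀ z, HasDerivAt F (F' z) z) ∧ (∃ M, ∀ x : ℝ, ‖F' x‖ ≤ M) ∧
      ∀ l : Filter ℝ, l.IsCountablyGenerated →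
        (∀ u, Tendsto (fun x => γ (x - u) - γ x) l (𝓝 0)) →
        Tendsto (fun x : ℝ => F x - γ x) l (𝓝 0) ∧ Tendsto (fun x : ℝ => F' x) l (𝓝 0) := by
  have hB : ∀ s, ‖γ s‖ ≤ (‖γ 0‖ + C) * (1 + |s|) := by
    intro s
    have h1 := hC s 0
    have h2 := norm_le_norm_add_norm_sub' (γ s) (γ 0)
    rw [sub_zero] at h1
    nlinarith [norm_nonneg (γ 0), abs_nonneg s, mul_nonneg (norm_nonneg (γ 0)) (abs_nonneg s)]
  have hnorm : ∀ u : ℝ, ‖Complex.exp (-(u : ℂ) ^ 2)‖ = Real.exp (-1 * u ^ 2) := by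
    intro u
    rw [neg_one_mul, ← Complex.norm_of_nonneg (Real.exp_pos _).le]
    simp
  let w₁ : ℝ → ℂ := fun u => Complex.exp (-(u : ℂ) ^ 2)
  let w₂ : ℝ → ℂ := fun u => -(2 * (u : ℂ)) * Complex.exp (-(u : ℂ) ^ 2)
  have hw₁ : Continuous w₁ := by fun_prop
  have hw₂ : Continuous w₂ := by fun_prop
  have hint := integrable_one_add_sq_mul_exp one_pos
  have hw₁i : Integrable fun u => (1 + |u|) * ‖w₁ u‖ := by
    refine (hint.const_mul 2).mono' (by fun_prop : Continuous _).aestronglyMeasurable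
      (.of_forall fun u => ?_)
    rw [Real.norm_of_nonneg (by positivity), hnorm, ← mul_assoc]
    gcongr
    nlinarith [sq_abs u, sq_nonneg (1 - |u|), abs_nonneg u]
  have hw₂i : Integrable fun u => (1 + |u|) * ‖w₂ u‖ := by
    refine (hint.const_mul 4).mono' (by fun_prop : Continuous _).aestronglyMeasurable
      (.of_forall fun u => ?_)
    rw [Real.norm_of_nonneg (by positivity)]
    simp only [w₂]
    rw [norm_mul, hnorm, norm_neg, norm_mul, Complex.norm_ofNat, Complex.norm_real,
      Real.norm_eq_abs, ← mul_assoc, ← mul_assoc]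
    rw [← mul_assoc 4]
    refine mul_le_mul_of_nonneg_right ?_ (Real.exp_pos _).le
    nlinarith [sq_abs u, sq_nonneg (1 - |u|), abs_nonneg u]
  have hw₁int : ∫ u, w₁ u = ((√Real.pi : ℝ) : ℂ) := by
    have := integral_gaussian 1
    rw [div_one] at this
    rw [← this, ← integral_complex_ofReal]
    congr with u
    simp [w₁]
  have hw₂int : ∫ u, w₂ u = 0 := by
    have h := integral_neg_eq_self w₂ volume
    have h' : ∀ u, w₂ (-u) = -w₂ u := fun u => by simp [w₂]
    simp only [h', integral_neg] at h
    exact CharZero.neg_eq_self_iff.1 h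
  have hpi : ((√Real.pi : ℝ) : ℂ) ≠ 0 := by
    simpa using (Real.sqrt_pos.2 Real.pi_pos).ne'
  have e₁ : ∀ x : ℝ, (∫ s : ℝ, γ s * Complex.exp (-((x : ℂ) - s) ^ 2)) =
      (∫ u, (γ (x - u) - γ x) * w₁ u) + γ x * ((√Real.pi : ℝ) : ℂ) := by
    intro x
    rw [← hw₁int, ← integral_comp_sub_mul_weight hγ hC hw₁ hw₁i, ← integral_sub_left_eq_self _ _ x]
    simp [w₁]
  have e₂ : ∀ x : ℝ, (∫ s : ℝ, γ s * (-(2 * ((x : ℂ) - s)) * Complex.exp (-((x : ℂ) - s) ^ 2))) =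
      ∫ u, (γ (x - u) - γ x) * w₂ u := by
    intro x
    have := integral_comp_sub_mul_weight hγ hC hw₂ hw₂i x
    rw [hw₂int, mul_zero, add_zero] at this
    rw [← this, ← integral_sub_left_eq_self _ _ x]
    simp [w₂]
  refine ⟨fun z => (∫ s : ℝ, γ s * Complex.exp (-(z - s) ^ 2)) / ((√Real.pi : ℝ) : ℂ), fun z =>
    (∫ s : ℝ, γ s * (-(2 * (z - s)) * Complex.exp (-(z - s) ^ 2))) / ((√Real.pi : ℝ) : ℂ),
    fun z => (hasDerivAt_integral_mul_gaussian hγ hB z).div_const _,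
    ⟨(∫ u, C * ((1 + |u|) * ‖w₂ u‖)) / ‖((√Real.pi : ℝ) : ℂ)‖, fun x => ?_⟩, fun l _ hl => ⟨?_, ?_⟩⟩
  · simp only [e₂, norm_div]
    gcongr
    exact norm_integral_sub_mul_weight_le hC hw₂i x
  · simp only [e₁, add_div, mul_div_cancel_right₀ _ hpi, add_sub_cancel_right]
    simpa using (tendsto_integral_sub_mul_weight hγ hC hw₁ hw₁i hl).div_const ((√Real.pi : ℝ) : ℂ)
  · simp only [e₂]
    simpa using (tendsto_integral_sub_mul_weight hγ hC hw₂ hw₂i hl).div_const ((√Real.pi : ℝ) : ℂ)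

open MeasureTheory in
lemma exists_tendsto_of_hasDerivAt_cexp_sq {g : ℝ → ℂ}
    (hg : ∀ t : ℝ, HasDerivAt g (Complex.exp (Complex.I * t ^ 2)) t) :
    ∃ c, Tendsto g atTop (𝓝 c) := by
  let e : ℝ → ℂ := fun t => Complex.exp (Complex.I * t ^ 2)
  have hnorm : ∀ t : ℝ, ‖e t‖ = 1 := fun t => by
    have := Complex.norm_exp_ofReal_mul_I (t ^ 2)
    rwa [Complex.ofReal_pow, mul_comm] at this
  have he : ∀ t : ℝ, HasDerivAt e (e t * (Complex.I * (2 * t))) t := by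
    intro t
    have := ((Complex.ofRealCLM.hasDerivAt (x := t)).pow 2).const_mul Complex.I
    simpa [e] using this.cexp
  let k : ℝ → ℂ := fun t => g t + Complex.I / 2 * ((t : ℂ)⁻¹ * e t)
  let k' : ℝ → ℂ := fun t => -(Complex.I / 2) * (((t ^ (-2 : ℝ) : ℝ) : ℂ) * e t)
  have hk : ∀ t ∈ Set.Ioi (1 : ℝ), HasDerivAt k (k' t) t := by
    intro t ht
    have ht0 : t ≠ 0 := (one_pos.trans ht).ne'
    have htC : (t : ℂ) ≠ 0 := by exact_mod_cast ht0
    have h1 : HasDerivAt (fun s : ℝ => (s : ℂ)⁻¹) (-((t : ℂ) ^ 2)⁻¹) t := by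
      have := (hasDerivAt_inv ht0).ofReal_comp
      simpa using this
    refine ((hg t).add ((h1.mul (he t)).const_mul (Complex.I / 2))).congr_deriv ?_
    have h2 : ((t ^ (-2 : ℝ) : ℝ) : ℂ) = ((t : ℂ) ^ 2)⁻¹ := by
      rw [Real.rpow_neg (one_pos.trans ht).le, Real.rpow_two]
      push_cast
      rfl
    simp only [k', h2]
    change e t + _ = _
    field_simp
    linear_combination (2 * e t * t ^ 2) * Complex.I_sq
  have hint : IntegrableOn k' (Set.Ioi 1) := by
    refine Integrable.const_mul ?_ _
    have h := integrableOn_Ioi_rpow_of_lt (a := -2) (by norm_num) one_pos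
    refine Integrable.mono (g := fun t : ℝ => ((t ^ (-2 : ℝ) : ℝ) : ℂ)) h.ofReal
      ((h.ofReal (𝕜 := ℂ)).aestronglyMeasurable.mul
      (by fun_prop : Continuous e).aestronglyMeasurable) (.of_forall fun t => ?_)
    rw [norm_mul, hnorm, mul_one]
  have hlim := tendsto_limUnder_of_hasDerivAt_of_integrableOn_Ioi hk hint
  have hz : Tendsto (fun t : ℝ => Complex.I / 2 * ((t : ℂ)⁻¹ * e t)) atTop (𝓝 0) := by
    rw [tendsto_zero_iff_norm_tendsto_zero]
    have : Tendsto (fun t : ℝ => ‖Complex.I / 2‖ * |t⁻¹|) atTop (𝓝 0) := by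
      simpa using (tendsto_inv_atTop_zero (𝕜 := ℝ)).abs.const_mul ‖Complex.I / 2‖
    refine this.congr fun t => ?_
    rw [norm_mul, norm_mul, hnorm, mul_one, norm_inv, Complex.norm_real, abs_inv, Real.norm_eq_abs]
  exact ⟨_, (hlim.sub hz).congr fun t => by simp [k]⟩

/-- The complex Fresnel integral is entire and converges at both ends of the line. -/
lemma exists_fresnel : ∃ h : ℂ → ℂ, (∀ z, HasDerivAt h (Complex.exp (Complex.I * z ^ 2)) z) ∧
    ∃ c d : ℂ, Tendsto (fun t : ℝ => h t) atTop (𝓝 c) ∧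
      Tendsto (fun t : ℝ => h t) atBot (𝓝 d) := by
  obtain ⟨h, hh⟩ := (by fun_prop :
    Differentiable ℂ fun z : ℂ => Complex.exp (Complex.I * z ^ 2)).isExactOn_univ
  have hh : ∀ z, HasDerivAt h (Complex.exp (Complex.I * z ^ 2)) z := fun z => hh z (Set.mem_univ z)
  obtain ⟨c, hc⟩ := exists_tendsto_of_hasDerivAt_cexp_sq fun t => (hh t).comp_ofReal
  have hneg : ∀ t : ℝ, HasDerivAt (fun t : ℝ => -h (-t)) (Complex.exp (Complex.I * t ^ 2)) t := by
    intro t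
    have h1 := (hh (-(t : ℂ))).comp (t : ℂ) (hasDerivAt_neg (t : ℂ))
    simpa using h1.neg.comp_ofReal
  obtain ⟨d, hd⟩ := exists_tendsto_of_hasDerivAt_cexp_sq hneg
  refine ⟨h, hh, c, -d, hc, ?_⟩
  exact (hd.neg.comp tendsto_neg_atBot_atTop).congr fun t => by simp

lemma OnePoint.tendsto_coe_of_tendsto_sub {α : Type*} {l : Filter α} {u v : α → ℂ}
    (huv : Tendsto (fun x => v x - u x) l (𝓝 0)) {w : OnePoint ℂ}
    (hu : Tendsto (fun x => (u x : OnePoint ℂ)) l (𝓝 w)) :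
    Tendsto (fun x => (v x : OnePoint ℂ)) l (𝓝 w) := by
  induction w using OnePoint.rec with
  | infty =>
    have hiff : ∀ f : α → ℂ, Tendsto (fun x => (f x : OnePoint ℂ)) l (𝓝 OnePoint.infty) ↔
        Tendsto (fun x => ‖f x‖) l atTop := by
      intro f
      rw [tendsto_norm_atTop_iff_cobounded, Metric.cobounded_eq_cocompact,
        ← coclosedCompact_eq_cocompact, ← OnePoint.comap_coe_nhds_infty, tendsto_comap_iff]
      rfl
    rw [hiff] at hu ⊢
    refine tendsto_atTop_mono' l ?_ (tendsto_atTop_add_const_right l (-1) hu)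
    filter_upwards [huv.norm.eventually (gt_mem_nhds (by simp : ‖(0 : ℂ)‖ < 1))] with x hx
    have := norm_sub_norm_le (u x) (v x)
    rw [norm_sub_rev] at this
    linarith
  | coe w =>
    have hiff : ∀ f : α → ℂ, Tendsto (fun x => (f x : OnePoint ℂ)) l (𝓝 w) ↔
        Tendsto f l (𝓝 w) := fun f =>
      (OnePoint.isOpenEmbedding_coe.isEmbedding.tendsto_nhds_iff).symm
    rw [hiff] at hu ⊢
    simpa using hu.add huv

lemma OnePoint.setOf_mapClusterPt_congr {α : Type*} {l : Filter α} {u v : α → ℂ}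
    (huv : Tendsto (fun x => v x - u x) l (𝓝 0)) :
    {w : OnePoint ℂ | MapClusterPt w l fun x => (v x : OnePoint ℂ)} =
      {w : OnePoint ℂ | MapClusterPt w l fun x => (u x : OnePoint ℂ)} := by
  ext w
  simp only [Set.mem_ofPred_eq, mapClusterPt_iff_ultrafilter]
  have hvu : Tendsto (fun x => u x - v x) l (𝓝 0) := by simpa using huv.neg
  exact ⟨fun ⟨U, hU, h⟩ => ⟨U, hU, tendsto_coe_of_tendsto_sub (hvu.mono_left hU) h⟩,
    fun ⟨U, hU, h⟩ => ⟨U, hU, tendsto_coe_of_tendsto_sub (huv.mono_left hU) h⟩⟩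

/-- Adding a perturbation tending to zero to the velocity of a Fresnel spiral does not make its
direction converge. -/
lemma not_tendsto_direction {G : ℝ → ℂ} {l : Filter ℝ} (hG : Tendsto G l (𝓝 0)) {M σ : ℝ}
    (hM : 0 < M) (hσ : σ ^ 2 = 1) (hσl : Tendsto (fun t => σ * t) atTop l) {v : ℝ → ℂ}
    (hv : ∀ t, v t = G t + M * Complex.exp (Complex.I * (M * t) ^ 2)) :
    ¬ ∃ c : ℂ, Tendsto (fun t : ℝ => v t / ‖v t‖) l (𝓝 c) := by
  rintro ⟨c, hc⟩
  have hMC : (M : ℂ) ≠ 0 := by exact_mod_cast hM.ne'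
  have key : ∀ θ : ℝ, 0 ≤ θ → c = Complex.exp (θ * Complex.I) := by
    intro θ hθ
    let t : ℕ → ℝ := fun n => σ * (√(n * (2 * Real.pi) + θ) / M)
    have ht : Tendsto t atTop l := by
      refine hσl.comp ((Real.tendsto_sqrt_atTop.comp ?_).atTop_div_const hM)
      exact tendsto_atTop_add_const_right _ _
        (tendsto_natCast_atTop_atTop.atTop_mul_const Real.two_pi_pos)
    have hvt : ∀ n, v (t n) = G (t n) + M * Complex.exp (θ * Complex.I) := by
      intro n
      have h1 : (M * t n) ^ 2 = n * (2 * Real.pi) + θ := by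
        have h2 : (M * t n) ^ 2 = σ ^ 2 * √(n * (2 * Real.pi) + θ) ^ 2 := by
          simp only [t]
          field_simp
        rw [h2, hσ, one_mul, Real.sq_sqrt (by positivity)]
      have h3 : Complex.I * ((M : ℂ) * (t n : ℂ)) ^ 2 =
          θ * Complex.I + n * (2 * Real.pi * Complex.I) := by
        have : ((M : ℂ) * (t n : ℂ)) ^ 2 = n * (2 * Real.pi) + θ := by exact_mod_cast h1
        rw [this]
        ring
      rw [hv, h3, Complex.exp_add, Complex.exp_nat_mul_two_pi_mul_I, mul_one]
    have hlim : Tendsto (fun n => v (t n)) atTop (𝓝 (M * Complex.exp (θ * Complex.I))) := by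
      simp only [hvt]
      simpa using (hG.comp ht).add_const ((M : ℂ) * Complex.exp (θ * Complex.I))
    have hnorm : ‖(M : ℂ) * Complex.exp (θ * Complex.I)‖ = M := by
      rw [norm_mul, Complex.norm_exp_ofReal_mul_I, mul_one, Complex.norm_real,
        Real.norm_of_nonneg hM.le]
    have hn : Tendsto (fun n => ((‖v (t n)‖ : ℝ) : ℂ)) atTop (𝓝 (M : ℂ)) := by
      have := (Complex.continuous_ofReal.tendsto _).comp hlim.norm
      rwa [hnorm] at this
    have hq := hlim.div hn hMC
    rw [mul_div_cancel_left₀ _ hMC] at hq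
    exact tendsto_nhds_unique (hc.comp ht) hq
  have h0 := key 0 le_rfl
  have hpi := key Real.pi Real.pi_pos.le
  rw [h0, Complex.exp_pi_mul_I] at hpi
  norm_num at hpi

lemma dist_le_mul_of_dist_succ_le {z : ℕ → ℂ} {ε : ℝ} {N : ℕ}
    (h : ∀ m ≥ N, dist (z m) (z (m + 1)) ≤ ε) {a b : ℕ} (ha : N ≤ a) (hb : N ≤ b) :
    dist (z a) (z b) ≤ ε * |(a : ℝ) - b| := by
  wlog hab : a ≤ b generalizing a b
  · rw [dist_comm, abs_sub_comm]
    exact this hb ha (le_of_not_ge hab)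
  induction b, hab using Nat.le_induction with
  | base => simp
  | succ b hab ih =>
    have h1 := ih (ha.trans hab)
    have h2 := h b (ha.trans hab)
    have hab' : (a : ℝ) ≤ b := by exact_mod_cast hab
    rw [abs_sub_comm, abs_of_nonneg (by linarith)] at h1
    rw [abs_sub_comm, abs_of_nonneg (by push_cast; linarith)]
    push_cast
    linarith [dist_triangle (z a) (z b) (z (b + 1))]

lemma abs_natFloor_sub_natFloor_le (x y : ℝ) : |(⌊x⌋₊ : ℝ) - ⌊y⌋₊| ≤ 1 + |x - y| := by
  wlog hxy : x ≤ y generalizing x y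
  · rw [abs_sub_comm, abs_sub_comm x]
    exact this y x (le_of_not_ge hxy)
  have hfl : (⌊x⌋₊ : ℝ) ≤ ⌊y⌋₊ := by exact_mod_cast Nat.floor_mono hxy
  rw [abs_sub_comm, abs_sub_comm x, abs_of_nonneg (by linarith), abs_of_nonneg (by linarith)]
  have h1 := Nat.sub_one_lt_floor x
  rcases le_or_gt 0 y with hy | hy
  · linarith [Nat.floor_le hy]
  · rw [Nat.floor_of_nonpos hy.le, Nat.floor_of_nonpos (hxy.trans hy.le)]
    simp; linarith

lemma dist_comp_natFloor_le {z : ℕ → ℂ} (hz : ∀ m, dist (z m) (z (m + 1)) ≤ 1) (x y : ℝ) :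
    dist (z ⌊x⌋₊) (z ⌊y⌋₊) ≤ 1 + |x - y| := by
  have := dist_le_mul_of_dist_succ_le (N := 0) (fun m _ => hz m) (Nat.zero_le ⌊x⌋₊)
    (Nat.zero_le ⌊y⌋₊)
  rw [one_mul] at this
  exact this.trans (abs_natFloor_sub_natFloor_le x y)

lemma tendsto_comp_natFloor_sub {z : ℕ → ℂ}
    (hz : Tendsto (fun m => dist (z m) (z (m + 1))) atTop (𝓝 0)) (u : ℝ) :
    Tendsto (fun x : ℝ => z ⌊x - u⌋₊ - z ⌊x⌋₊) atTop (𝓝 0) := by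
  rw [Metric.tendsto_nhds]
  intro δ hδ
  have hpos : 0 < 2 + |u| := by positivity
  obtain ⟨N, hN⟩ := eventually_atTop.1 (hz.eventually (gt_mem_nhds (div_pos hδ hpos)))
  have h1 : ∀ᶠ x : ℝ in atTop, N ≤ ⌊x⌋₊ := tendsto_nat_floor_atTop.eventually_ge_atTop N
  have h2 : ∀ᶠ x : ℝ in atTop, N ≤ ⌊x - u⌋₊ :=
    (tendsto_atTop_add_const_right _ (-u) tendsto_id).eventually h1
  filter_upwards [h1, h2] with x hx hxu
  rw [dist_zero_right, ← dist_eq_norm]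
  have h3 := dist_le_mul_of_dist_succ_le (fun m hm => (hN m hm).le) hxu hx
  have h4 := abs_natFloor_sub_natFloor_le (x - u) x
  rw [sub_sub_cancel_left, abs_neg] at h4
  calc dist (z ⌊x - u⌋₊) (z ⌊x⌋₊) ≤ δ / (2 + |u|) * (1 + |u|) := h3.trans (by gcongr)
    _ < δ / (2 + |u|) * (2 + |u|) := by gcongr; norm_num
    _ = δ := div_mul_cancel₀ _ hpos.ne'

lemma map_natFloor_atTop : map (fun x : ℝ => ⌊x⌋₊) atTop = atTop := by
  refine le_antisymm tendsto_nat_floor_atTop fun s hs => ?_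
  obtain ⟨a, ha⟩ := mem_atTop_sets.1 (mem_map.1 hs)
  refine mem_atTop_sets.2 ⟨⌈a⌉₊, fun n hn => ?_⟩
  simpa using ha n (Nat.ceil_le.1 hn)

lemma setOf_mapClusterPt_comp_natFloor {z : ℕ → ℂ} {l : Filter ℝ} {g : ℝ → ℝ}
    (hg : map g l = atTop) :
    {w : OnePoint ℂ | MapClusterPt w l fun t => (z ⌊g t⌋₊ : OnePoint ℂ)} =
      {w : OnePoint ℂ | MapClusterPt w atTop fun m => (z m : OnePoint ℂ)} := by
  ext w
  have : map (fun t => (z ⌊g t⌋₊ : OnePoint ℂ)) l = map (fun m => (z m : OnePoint ℂ)) atTop := by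
    rw [← map_natFloor_atTop, ← hg, map_map, map_map]
    rfl
  simp only [Set.mem_ofPred_eq, MapClusterPt, this]

/-- A slowly varying step function following one sequence to the right and another one to the
left, up to prescribed constants. -/
lemma exists_step_function {zp zn : ℕ → ℂ} (hp : ∀ m, dist (zp m) (zp (m + 1)) ≤ 1)
    (hp0 : Tendsto (fun m => dist (zp m) (zp (m + 1))) atTop (𝓝 0))
    (hn : ∀ m, dist (zn m) (zn (m + 1)) ≤ 1)
    (hn0 : Tendsto (fun m => dist (zn m) (zn (m + 1))) atTop (𝓝 0)) (c d : ℂ) :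
    ∃ γ : ℝ → ℂ, Measurable γ ∧ (∃ C, ∀ x y, ‖γ x - γ y‖ ≤ C * (1 + |x - y|)) ∧
      (∀ u, Tendsto (fun x => γ (x - u) - γ x) atTop (𝓝 0)) ∧
      (∀ u, Tendsto (fun x => γ (x - u) - γ x) atBot (𝓝 0)) ∧
      (∀ᶠ x in atTop, γ x = zp ⌊x⌋₊ - c) ∧ ∀ᶠ x in atBot, γ x = zn ⌊-x⌋₊ - d := by
  let γ : ℝ → ℂ := fun x =>
    zp ⌊x⌋₊ + zn ⌊-x⌋₊ + if 0 ≤ x then -zn 0 - c else -zp 0 - d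
  have htop : ∀ᶠ x in atTop, γ x = zp ⌊x⌋₊ - c := by
    filter_upwards [eventually_ge_atTop 0] with x hx
    simp only [γ, if_pos hx, Nat.floor_of_nonpos (neg_nonpos.2 hx)]
    ring
  have hbot : ∀ᶠ x in atBot, γ x = zn ⌊-x⌋₊ - d := by
    filter_upwards [eventually_lt_atBot 0] with x hx
    simp only [γ, if_neg hx.not_ge, Nat.floor_of_nonpos hx.le]
    ring
  refine ⟨γ, ?_, ⟨2 + ‖(-zn 0 - c) - (-zp 0 - d)‖, fun x y => ?_⟩, fun u => ?_, fun u => ?_,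
    htop, hbot⟩
  · have h1 : Measurable fun x : ℝ => zp ⌊x⌋₊ := measurable_from_nat.comp Nat.measurable_floor
    have h2 : Measurable fun x : ℝ => zn ⌊-x⌋₊ :=
      measurable_from_nat.comp (Nat.measurable_floor.comp measurable_neg)
    exact (h1.add h2).add (Measurable.ite measurableSet_Ici measurable_const measurable_const)
  · have h1 := dist_comp_natFloor_le hp x y
    have h2 := dist_comp_natFloor_le hn (-x) (-y)
    rw [neg_sub_neg, abs_sub_comm] at h2
    set A := -zn 0 - c
    set B := -zp 0 - d
    have h3 : ‖(if 0 ≤ x then A else B) - (if 0 ≤ y then A else B)‖ ≤ ‖A - B‖ := by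
      split_ifs <;> simp [norm_sub_rev]
    have h4 : γ x - γ y = (zp ⌊x⌋₊ - zp ⌊y⌋₊) + (zn ⌊-x⌋₊ - zn ⌊-y⌋₊) +
        ((if 0 ≤ x then A else B) - (if 0 ≤ y then A else B)) := by
      simp only [γ]
      ring
    rw [dist_eq_norm] at h1 h2
    rw [h4]
    refine norm_add₃_le.trans ?_
    nlinarith [abs_nonneg (x - y), mul_nonneg (norm_nonneg (A - B)) (abs_nonneg (x - y))]
  · refine (tendsto_comp_natFloor_sub hp0 u).congr' ?_
    filter_upwards [htop, (tendsto_atTop_add_const_right _ (-u) tendsto_id).eventually htop]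
      with x hx hxu
    rw [hx]
    change γ (x - u) = zp ⌊x - u⌋₊ - c at hxu
    rw [hxu]
    ring
  · refine ((tendsto_comp_natFloor_sub hn0 (-u)).comp tendsto_neg_atBot_atTop).congr' ?_
    filter_upwards [hbot, (tendsto_atBot_add_const_right _ (-u) tendsto_id).eventually hbot]
      with x hx hxu
    rw [hx]
    change γ (x - u) = zn ⌊-(x - u)⌋₊ - d at hxu
    rw [hxu, neg_sub, Function.comp_apply, sub_neg_eq_add, neg_add_eq_sub]
    ring

/-- For any two continua `K⁻` and `K⁺` in the Riemann sphere `OnePoint ℂ`, there exists an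
entire function `f : ℂ → ℂ` with nonvanishing derivative on the real line, whose restriction
to the real line has cluster set `K⁻` at `-∞` and `K⁺` at `+∞`, and whose normalized tangent
direction `t ↦ deriv f t / ‖deriv f t‖` diverges both as `t → +∞` and as `t → -∞`. -/
theorem entire_curve_with_prescribed_cluster_sets_maximal
    (Kneg Kpos : Set (OnePoint ℂ))
    (hKnegC : IsCompact Kneg) (hKnegConn : IsConnected Kneg)
    (hKposC : IsCompact Kpos) (hKposConn : IsConnected Kpos) :
    ∃ f : ℂ → ℂ, Differentiable ℂ f ∧ (∀ x : ℝ, deriv f x ≠ 0) ∧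
      {w : OnePoint ℂ | MapClusterPt w atBot fun t : ℝ => ((f t : ℂ) : OnePoint ℂ)} = Kneg ∧
      {w : OnePoint ℂ | MapClusterPt w atTop fun t : ℝ => ((f t : ℂ) : OnePoint ℂ)} = Kpos ∧
      (¬ ∃ c : ℂ, Tendsto (fun t : ℝ => deriv f t / ‖deriv f t‖) atTop (𝓝 c)) ∧
      (¬ ∃ c : ℂ, Tendsto (fun t : ℝ => deriv f t / ‖deriv f t‖) atBot (𝓝 c)) := by
  obtain ⟨zp, hp, hp0, hpK⟩ := exists_seq_cluster_eq hKposC hKposConn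
  obtain ⟨zn, hn, hn0, hnK⟩ := exists_seq_cluster_eq hKnegC hKnegConn
  obtain ⟨h, hh, c, d, hc, hd⟩ := exists_fresnel
  obtain ⟨γ, hγ, ⟨C, hC⟩, htop, hbot, hγtop, hγbot⟩ := exists_step_function hp hp0 hn hn0 c d
  obtain ⟨F, F', hF, ⟨B, hB⟩, hlim⟩ := exists_entire_approx hγ hC
  obtain ⟨hFtop, hFtop'⟩ := hlim atTop inferInstance htop
  obtain ⟨hFbot, hFbot'⟩ := hlim atBot inferInstance hbot
  have hB0 : 0 ≤ B := (norm_nonneg _).trans (hB 0)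
  obtain ⟨M, hM⟩ : ∃ M, M = B + 1 := ⟨_, rfl⟩
  have hM0 : 0 < M := by linarith
  have hderiv : ∀ z : ℂ, HasDerivAt (fun z => F z + h (M * z))
      (F' z + M * Complex.exp (Complex.I * (M * z) ^ 2)) z := by
    intro z
    have h1 := (hh (M * z)).comp z ((hasDerivAt_id z).const_mul (M : ℂ))
    refine ((hF z).add h1).congr_deriv ?_
    simp [mul_comm]
  have hderiv' : ∀ z : ℂ, deriv (fun z => F z + h (M * z)) z =
      F' z + M * Complex.exp (Complex.I * (M * z) ^ 2) := fun z => (hderiv z).deriv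
  have hctop : Tendsto (fun t : ℝ => h (M * t)) atTop (𝓝 c) := by
    have := hc.comp (tendsto_id.const_mul_atTop hM0)
    simpa [Function.comp_def] using this
  have hdbot : Tendsto (fun t : ℝ => h (M * t)) atBot (𝓝 d) := by
    have := hd.comp (tendsto_id.const_mul_atBot hM0)
    simpa [Function.comp_def] using this
  refine ⟨fun z => F z + h (M * z), fun z => (hderiv z).differentiableAt, fun x => ?_, ?_, ?_,
    not_tendsto_direction hFtop' hM0 (σ := 1) (by norm_num)
      (tendsto_id.congr fun t => (one_mul t).symm)
      fun t => hderiv' t,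
    not_tendsto_direction hFbot' hM0 (σ := -1) (by norm_num)
      (by simpa using tendsto_neg_atTop_atBot) fun t => hderiv' t⟩
  · rw [hderiv']
    intro h0
    have h1 : ‖(M : ℂ) * Complex.exp (Complex.I * (M * x) ^ 2)‖ = M := by
      have := Complex.norm_exp_ofReal_mul_I ((M * x) ^ 2)
      push_cast at this
      rw [norm_mul, mul_comm Complex.I, this, mul_one, Complex.norm_real,
        Real.norm_of_nonneg hM0.le]
    have h2 := hB x
    rw [eq_neg_of_add_eq_zero_left h0, norm_neg, h1] at h2
    linarith
  · rw [← hnK, ← setOf_mapClusterPt_comp_natFloor (g := fun t => -t) (l := atBot)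
      map_neg_atBot]
    refine OnePoint.setOf_mapClusterPt_congr ?_
    have := hFbot.add (hdbot.sub_const d)
    rw [sub_self, add_zero] at this
    refine this.congr' ?_
    filter_upwards [hγbot] with t ht
    rw [ht]
    ring
  · rw [← hpK, ← setOf_mapClusterPt_comp_natFloor (g := fun t => t) (l := atTop) map_id]
    refine OnePoint.setOf_mapClusterPt_congr ?_
    have := hFtop.add (hctop.sub_const c)
    rw [sub_self, add_zero] at this
    refine this.congr' ?_
    filter_upwards [hγtop] with t ht
    rw [ht]
    ring
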